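/- arXiv:1108.1810 — 3 statements merged into one kernel-verified Lean document; each statement's English description precedes it below -/
import Mathlib

section
/- Let V be a real vector space graded as V = ⊕_{k∈ℕ} V^k with each V^k finite dimensional, and let l₁,l₂,l₃ (of degree +1) and λ₁,λ₂,λ₃ (of degree −1) be endomorphisms of V satisfying λ_α ∘ l_β + l_β ∘ λ_α = δ_{αβ}·id, λ_α ∘ λ_β + λ_β ∘ λ_α = 0, and l_α ∘ l_β + l_β ∘ l_α = 0 for all α, β ∈ {1,2,3}. Set e_α := l_α ∘ λ_α, and let a_k := dim {v ∈ V^k : e_α v = 0 for α = 1,2,3} (with a_j := 0 for j < 0). Then for every k, dim V^k = a_k + 3a_{k−1} + 3a_{k−2} + a_{k−3}. -/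
section

variable {K V : Type*} [Field K] [AddCommGroup V] [Module K V]

theorem ker_mul_eq_ker_of_anticomm {l lam : Module.End K V}
    (h1 : lam * l + l * lam = 1) (h2 : lam * lam = 0) :
    LinearMap.ker (l * lam) = LinearMap.ker lam := by
  ext v
  have e1 := LinearMap.congr_fun h1 (lam v)
  have e2 := LinearMap.congr_fun h2 v
  simp only [LinearMap.add_apply, Module.End.mul_apply, Module.End.one_apply,
    LinearMap.zero_apply] at e1 e2
  simp only [LinearMap.mem_ker, Module.End.mul_apply]
  refine ⟨fun h => ?_, fun h => by rw [h, map_zero]⟩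
  rw [← e1, h, e2, map_zero, map_zero, add_zero]

/-- Rank-nullity for an annihilation operator `lam : A → B`, whose range is `B ⊓ ker lam`. -/
theorem finrank_eq_finrank_inf_ker_add {l lam : Module.End K V} (A B : Submodule K V)
    [FiniteDimensional K A] (h1 : lam * l + l * lam = 1) (h2 : lam * lam = 0)
    (hlam : ∀ v ∈ A, lam v ∈ B) (hl : ∀ v ∈ B, l v ∈ A) :
    Module.finrank K A = Module.finrank K (A ⊓ LinearMap.ker lam : Submodule K V) +
      Module.finrank K (B ⊓ LinearMap.ker lam : Submodule K V) := by
  have hrange : LinearMap.range (lam.domRestrict A) = B ⊓ LinearMap.ker lam := by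
    ext w
    simp only [LinearMap.mem_range, Submodule.mem_inf, LinearMap.mem_ker]
    constructor
    · rintro ⟨v, rfl⟩
      exact ⟨hlam v v.2, LinearMap.congr_fun h2 v⟩
    · rintro ⟨hw, hw0⟩
      refine ⟨⟨l w, hl w hw⟩, ?_⟩
      have e1 := LinearMap.congr_fun h1 w
      simpa [hw0] using e1
  have hker : (LinearMap.ker (lam.domRestrict A)).map A.subtype = A ⊓ LinearMap.ker lam := by
    ext w
    simp [and_comm]
  rw [← LinearMap.finrank_range_add_finrank_ker (lam.domRestrict A), hrange, ← hker,
    Submodule.finrank_map_subtype_eq, add_comm]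

theorem apply_mem_ker_of_anticomm {f g : Module.End K V} (h : f * g + g * f = 0) {v : V}
    (hv : v ∈ LinearMap.ker f) : g v ∈ LinearMap.ker f := by
  have e := LinearMap.congr_fun h v
  rw [LinearMap.mem_ker] at hv ⊢
  simpa [hv] using e

/-- A degree `-1` annihilation operator kills the bottom graded piece. -/
theorem apply_eq_zero_of_mem_zero {l lam : Module.End K V} {W : ℕ → Submodule K V}
    (hgrad : DirectSum.IsInternal W) (h1 : lam * l + l * lam = 1) (h2 : lam * lam = 0)
    (hl : ∀ k, (W k).map l ≤ W (k + 1)) (hlam : ∀ k, (W (k + 1)).map lam ≤ W k)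
    {v : V} (hv : v ∈ W 0) : lam v = 0 := by
  have hrange : LinearMap.range l ≤ ⨆ j, ⨆ (_ : j ≠ 0), W j := by
    rw [LinearMap.range_eq_map, ← hgrad.submodule_iSup_eq_top, Submodule.map_iSup]
    exact iSup_le fun k => (hl k).trans (le_iSup₂_of_le (k + 1) k.succ_ne_zero le_rfl)
  have e1 := LinearMap.congr_fun h1 v
  simp only [LinearMap.add_apply, Module.End.mul_apply, Module.End.one_apply] at e1
  have hmem : l (lam v) ∈ W 0 := by
    rw [← eq_sub_iff_add_eq'] at e1
    rw [e1]
    exact sub_mem hv (hlam 0 ⟨_, hl 0 ⟨v, hv, rfl⟩, rfl⟩)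
  have h0 : l (lam v) = 0 :=
    Submodule.disjoint_def.mp (hgrad.submodule_iSupIndep 0) _ hmem (hrange ⟨_, rfl⟩)
  have hv' : v ∈ LinearMap.ker (l * lam) := h0
  rwa [ker_mul_eq_ker_of_anticomm h1 h2] at hv'

end


/-- Let `V = ⊕_{k∈ℕ} V^k` be a graded real vector space with
finite-dimensional pieces, `l α` of degree `+1` and `λ α` of degree `-1`
satisfying the anticommutation relations of Statement 0.  With
`a k := dim {v ∈ V^k | e α v = 0, α = 1,2,3}` (and `a j = 0` for `j < 0`),
one has `dim V^k = a k + 3 a (k-1) + 3 a (k-2) + a (k-3)` for every `k`. -/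
theorem stmt3 {V : Type*} [AddCommGroup V] [Module ℝ V]
    (Vk : ℕ → Submodule ℝ V)
    (hgrad : DirectSum.IsInternal Vk)
    (hfin : ∀ k, FiniteDimensional ℝ (Vk k))
    (l lam : Fin 3 → Module.End ℝ V)
    (h1 : ∀ α β, lam α * l β + l β * lam α = if α = β then 1 else 0)
    (h2 : ∀ α β, lam α * lam β + lam β * lam α = 0)
    (h3 : ∀ α β, l α * l β + l β * l α = 0)
    (hl : ∀ (α : Fin 3) (k : ℕ), (Vk k).map (l α) ≤ Vk (k + 1))
    (hlam : ∀ (α : Fin 3) (k : ℕ), (Vk (k + 1)).map (lam α) ≤ Vk k)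
    (a : ℤ → ℕ)
    (ha_neg : ∀ j : ℤ, j < 0 → a j = 0)
    (ha : ∀ k : ℕ, a k =
      Module.finrank ℝ (Vk k ⊓ ⨅ α : Fin 3, LinearMap.ker (l α * lam α) : Submodule ℝ V)) :
    ∀ k : ℕ, Module.finrank ℝ (Vk k) =
      a k + 3 * a ((k : ℤ) - 1) + 3 * a ((k : ℤ) - 2) + a ((k : ℤ) - 3) := by
  have h11 : ∀ α, lam α * l α + l α * lam α = 1 := fun α => by simpa using h1 α α
  have h22 : ∀ α, lam α * lam α = 0 := fun α => by
    simpa [← two_smul ℝ] using h2 α α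
  have hl' : ∀ α k, ∀ v ∈ Vk k, l α v ∈ Vk (k + 1) := fun α k v hv => hl α k ⟨v, hv, rfl⟩
  have hlam' : ∀ α k, ∀ v ∈ Vk (k + 1), lam α v ∈ Vk k := fun α k v hv => hlam α k ⟨v, hv, rfl⟩
  have kl : ∀ α β, α ≠ β → ∀ v ∈ LinearMap.ker (lam α), l β v ∈ LinearMap.ker (lam α) :=
    fun α β hne _ => apply_mem_ker_of_anticomm (by simpa [hne] using h1 α β)
  have klam : ∀ α β, ∀ v ∈ LinearMap.ker (lam α), lam β v ∈ LinearMap.ker (lam α) :=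
    fun α β _ => apply_mem_ker_of_anticomm (h2 α β)
  set W₁ : ℕ → Submodule ℝ V := fun k => Vk k ⊓ LinearMap.ker (lam 0) with hW₁
  set W₂ : ℕ → Submodule ℝ V := fun k => W₁ k ⊓ LinearMap.ker (lam 1) with hW₂
  set W₃ : ℕ → Submodule ℝ V := fun k => W₂ k ⊓ LinearMap.ker (lam 2) with hW₃
  have r₁ : ∀ k, Module.finrank ℝ (Vk (k + 1)) =
      Module.finrank ℝ (W₁ (k + 1)) + Module.finrank ℝ (W₁ k) := fun k =>
    finrank_eq_finrank_inf_ker_add _ _ (h11 0) (h22 0) (hlam' 0 k) (hl' 0 k)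
  have r₂ : ∀ k, Module.finrank ℝ (W₁ (k + 1)) =
      Module.finrank ℝ (W₂ (k + 1)) + Module.finrank ℝ (W₂ k) := fun k =>
    finrank_eq_finrank_inf_ker_add _ _ (h11 1) (h22 1)
      (fun v hv => ⟨hlam' 1 k v hv.1, klam 0 1 v hv.2⟩)
      (fun v hv => ⟨hl' 1 k v hv.1, kl 0 1 (by decide) v hv.2⟩)
  have r₃ : ∀ k, Module.finrank ℝ (W₂ (k + 1)) =
      Module.finrank ℝ (W₃ (k + 1)) + Module.finrank ℝ (W₃ k) := fun k =>
    finrank_eq_finrank_inf_ker_add _ _ (h11 2) (h22 2)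
      (fun v hv => ⟨⟨hlam' 2 k v hv.1.1, klam 0 2 v hv.1.2⟩, klam 1 2 v hv.2⟩)
      (fun v hv => ⟨⟨hl' 2 k v hv.1.1, kl 0 2 (by decide) v hv.1.2⟩,
        kl 1 2 (by decide) v hv.2⟩)
  have hbot : ∀ α, Vk 0 ≤ LinearMap.ker (lam α) := fun α _ hv =>
    apply_eq_zero_of_mem_zero hgrad (h11 α) (h22 α) (hl α) (hlam α) hv
  have z₁ : W₁ 0 = Vk 0 := inf_eq_left.mpr (hbot 0)
  have z₂ : W₂ 0 = Vk 0 := by simp only [hW₂, z₁, inf_eq_left.mpr (hbot 1)]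
  have z₃ : W₃ 0 = Vk 0 := by simp only [hW₃, z₂, inf_eq_left.mpr (hbot 2)]
  have ha' : ∀ k : ℕ, a k = Module.finrank ℝ (W₃ k) := fun k => by
    have hW : Vk k ⊓ ⨅ α, LinearMap.ker (lam α) = W₃ k := by
      ext v
      simp [hW₁, hW₂, hW₃, Fin.forall_fin_succ, and_assoc]
    rw [ha, iInf_congr fun α => ker_mul_eq_ker_of_anticomm (h11 α) (h22 α), hW]
  intro k
  match k with
  | 0 =>
    rw [ha_neg (_ - 1) (by simp), ha_neg (_ - 2) (by simp), ha_neg (_ - 3) (by simp),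
      ha', z₃, mul_zero, add_zero, add_zero, add_zero]
  | 1 =>
    rw [show ((1 : ℕ) : ℤ) - 1 = (0 : ℕ) by simp, ha_neg (_ - 2) (by simp),
      ha_neg (_ - 3) (by simp), ha', ha', r₁, r₂, r₃, z₁, z₂, z₃]
    ring
  | 2 =>
    rw [show ((2 : ℕ) : ℤ) - 1 = (1 : ℕ) by simp, show ((2 : ℕ) : ℤ) - 2 = (0 : ℕ) by simp,
      ha_neg (_ - 3) (by simp), ha', ha', ha', r₁, r₂, r₂, r₃, r₃, z₂, z₃]
    ring
  | n + 3 =>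
    rw [show ((n + 3 : ℕ) : ℤ) - 1 = (n + 2 : ℕ) by push_cast; ring,
      show ((n + 3 : ℕ) : ℤ) - 2 = (n + 1 : ℕ) by push_cast; ring,
      show ((n + 3 : ℕ) : ℤ) - 3 = (n : ℕ) by push_cast; ring, ha', ha', ha', ha']
    have := r₁ (n + 2)
    have := r₂ (n + 2)
    have := r₂ (n + 1)
    have := r₃ (n + 2)
    have := r₃ (n + 1)
    have := r₃ n
    lia
end

section
/- Let g be a Lie algebra over ℝ and let H, L₁, L₂, L₃, Λ₁, Λ₂, Λ₃ ∈ g satisfy, for all α, β ∈ {1,2,3} and every cyclic permutation (α,β,γ) of (1,2,3): [L_α, L_β] = 0, [Λ_α, Λ_β] = 0, [L_α, Λ_α] = −H, [L_α, H] = 2L_α, [Λ_α, H] = −2Λ_α, and, defining K_α := [L_β, Λ_γ], also [L_α, Λ_γ] = −K_β. Then for every cyclic permutation (α,β,γ) of (1,2,3): [K_α, H] = 0, [K_α, L_α] = 0, [K_α, Λ_α] = 0, [K_α, L_β] = −2L_γ, [K_α, L_γ] = 2L_β, [K_α, Λ_β] = −2Λ_γ, [K_α, Λ_γ] = 2Λ_β,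 and [K_α, K_β] = −2K_γ. In particular the linear span of {H, L_α, Λ_α, K_α : α = 1,2,3} is a Lie subalgebra of g. -/
/-- If the brackets of a set of generators lie in its span, the span is closed under the bracket. -/
theorem lie_mem_span_of_forall_mem {R g : Type*} [CommRing R] [LieRing g] [LieAlgebra R g]
    {s : Set g} (h : ∀ x ∈ s, ∀ y ∈ s, ⁅x, y⁆ ∈ Submodule.span R s) {x y : g}
    (hx : x ∈ Submodule.span R s) (hy : y ∈ Submodule.span R s) :
    ⁅x, y⁆ ∈ Submodule.span R s := by
  induction hx, hy using Submodule.span_induction₂ with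
  | mem_mem x y hx hy => exact h x hx y hy
  | zero_left y hy => simp
  | zero_right x hx => simp
  | add_left x y z _ _ _ hxz hyz => rw [add_lie]; exact add_mem hxz hyz
  | add_right x y z _ _ _ hxy hxz => rw [lie_add]; exact add_mem hxy hxz
  | smul_left r x y _ _ hxy => rw [smul_lie]; exact Submodule.smul_mem _ r hxy
  | smul_right r x y _ _ hxy => rw [lie_smul]; exact Submodule.smul_mem _ r hxy

/-- Every index in `Fin 3` is reached from a given one by a cyclic shift. -/
theorem Fin.eq_or_eq_add_one_or_eq_add_two (a b : Fin 3) : b = a ∨ b = a + 1 ∨ b = a + 2 := by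
  decide +revert

/-- In a real Lie algebra, given `H, L α, Λ α` (`α ∈ {1,2,3}`,
indexed here by `Fin 3`, cyclic permutations `(α,β,γ)` of `(1,2,3)` being
`(α, α+1, α+2)`) satisfying `[L α, L β] = 0`, `[Λ α, Λ β] = 0`,
`[L α, Λ α] = −H`, `[L α, H] = 2 L α`, `[Λ α, H] = −2 Λ α`, and — with
`K α := [L (α+1), Λ (α+2)]` — also `[L α, Λ (α+2)] = −K (α+1)`, the stated
commutation relations for the `K α` hold, and in particular the linear span of
`{H, L α, Λ α, K α}` is closed under the Lie bracket (a Lie subalgebra). -/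
theorem stmt5 {g : Type*} [LieRing g] [LieAlgebra ℝ g]
    (H : g) (L Lam K : Fin 3 → g)
    (hK : ∀ α, K α = ⁅L (α + 1), Lam (α + 2)⁆)
    (hLL : ∀ α β, ⁅L α, L β⁆ = 0)
    (hLamLam : ∀ α β, ⁅Lam α, Lam β⁆ = 0)
    (hLLam : ∀ α, ⁅L α, Lam α⁆ = -H)
    (hLH : ∀ α, ⁅L α, H⁆ = (2 : ℝ) • L α)
    (hLamH : ∀ α, ⁅Lam α, H⁆ = -((2 : ℝ) • Lam α))
    (hLLam2 : ∀ α, ⁅L α, Lam (α + 2)⁆ = -K (α + 1)) :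
    (∀ α, ⁅K α, H⁆ = 0) ∧
    (∀ α, ⁅K α, L α⁆ = 0) ∧
    (∀ α, ⁅K α, Lam α⁆ = 0) ∧
    (∀ α, ⁅K α, L (α + 1)⁆ = -((2 : ℝ) • L (α + 2))) ∧
    (∀ α, ⁅K α, L (α + 2)⁆ = (2 : ℝ) • L (α + 1)) ∧
    (∀ α, ⁅K α, Lam (α + 1)⁆ = -((2 : ℝ) • Lam (α + 2))) ∧
    (∀ α, ⁅K α, Lam (α + 2)⁆ = (2 : ℝ) • Lam (α + 1)) ∧
    (∀ α, ⁅K α, K (α + 1)⁆ = -((2 : ℝ) • K (α + 2))) ∧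
    (∀ x ∈ Submodule.span ℝ ({H} ∪ Set.range L ∪ Set.range Lam ∪ Set.range K),
     ∀ y ∈ Submodule.span ℝ ({H} ∪ Set.range L ∪ Set.range Lam ∪ Set.range K),
      ⁅x, y⁆ ∈ Submodule.span ℝ ({H} ∪ Set.range L ∪ Set.range Lam ∪ Set.range K)) := by
  have h11 : ∀ α : Fin 3, α + 1 + 1 = α + 2 := by decide
  have h12 : ∀ α : Fin 3, α + 1 + 2 = α := by decide
  have h21 : ∀ α : Fin 3, α + 2 + 1 = α := by decide
  have h22 : ∀ α : Fin 3, α + 2 + 2 = α + 1 := by decide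
  have hLLam1 : ∀ α, ⁅L α, Lam (α + 1)⁆ = K (α + 2) := fun α => by
    rw [hK (α + 2), h21, h22]
  have hK' : ∀ α, K α = -⁅L (α + 2), Lam (α + 1)⁆ := fun α => by
    have h := hLLam2 (α + 2)
    rw [h22, h21] at h
    rw [h, neg_neg]
  have skew : ∀ x y : g, ⁅y, x⁆ = -⁅x, y⁆ := fun x y => (lie_skew y x).symm
  have hKH : ∀ α, ⁅K α, H⁆ = 0 := fun α => by
    rw [hK, lie_lie, hLamH, hLH, lie_neg, lie_smul, lie_smul, skew (L _) (Lam _),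
      smul_neg, sub_neg_eq_add, neg_add_cancel]
  have hKL₁ : ∀ α, ⁅K α, L (α + 1)⁆ = -((2 : ℝ) • L (α + 2)) := fun α => by
    rw [hK', neg_lie, lie_lie, hLL, skew (L _) (Lam _), hLLam, neg_neg, hLH, lie_zero, sub_zero]
  have hKL₂ : ∀ α, ⁅K α, L (α + 2)⁆ = (2 : ℝ) • L (α + 1) := fun α => by
    rw [hK, lie_lie, hLL, skew (L _) (Lam _), hLLam, neg_neg, hLH, lie_zero, sub_zero]
  have hKLam₁ : ∀ α, ⁅K α, Lam (α + 1)⁆ = -((2 : ℝ) • Lam (α + 2)) := fun α => by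
    rw [hK, lie_lie, hLamLam, hLLam, lie_neg, hLamH, lie_zero, zero_sub, neg_neg]
  have hKLam₂ : ∀ α, ⁅K α, Lam (α + 2)⁆ = (2 : ℝ) • Lam (α + 1) := fun α => by
    rw [hK', neg_lie, lie_lie, hLamLam, hLLam, lie_neg, hLamH, lie_zero, zero_sub, neg_neg,
      neg_neg]
  have self_eq_zero : ∀ f : Fin 3 → g, (∀ α, f α = -f (α + 1)) → ∀ α, f α = 0 := by
    intro f hf α
    have h₁ := hf α
    rw [hf (α + 1), h11, hf (α + 2), h21, neg_neg] at h₁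
    have : IsAddTorsionFree g := .of_isTorsionFree ℝ g
    exact self_eq_neg.mp h₁
  have hKL₀ : ∀ α, ⁅K α, L α⁆ = 0 := self_eq_zero (fun α => ⁅K α, L α⁆) fun α => by
    rw [hK α, lie_lie, hLL, skew (L α) (Lam _), hLLam2, neg_neg, lie_zero, sub_zero,
      skew (K _) (L _)]
  have hKLam₀ : ∀ α, ⁅K α, Lam α⁆ = 0 := self_eq_zero (fun α => ⁅K α, Lam α⁆) fun α => by
    have h := hLLam1 (α + 2)
    rw [h21, h22] at h
    rw [hK', neg_lie, lie_lie, hLamLam, h, lie_zero, zero_sub, neg_neg, skew (K _) (Lam _)]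
  have hKK : ∀ α, ⁅K α, K (α + 1)⁆ = -((2 : ℝ) • K (α + 2)) := fun α => by
    have h := hLLam2 (α + 1)
    rw [h12, h11] at h
    rw [hK (α + 1), h11, h12, leibniz_lie, hKL₂, hKLam₀, lie_zero, add_zero, smul_lie, h, smul_neg]
  refine ⟨hKH, hKL₀, hKLam₀, hKL₁, hKL₂, hKLam₁, hKLam₂, hKK, fun x hx y hy =>
    lie_mem_span_of_forall_mem ?_ hx hy⟩
  set S := Submodule.span ℝ ({H} ∪ Set.range L ∪ Set.range Lam ∪ Set.range K)
  have mH : H ∈ S := Submodule.subset_span (by simp)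
  have mL : ∀ α, L α ∈ S := fun α => Submodule.subset_span (by simp)
  have mLam : ∀ α, Lam α ∈ S := fun α => Submodule.subset_span (by simp)
  have mK : ∀ α, K α ∈ S := fun α => Submodule.subset_span (by simp)
  have swap : ∀ {x y : g}, ⁅x, y⁆ ∈ S → ⁅y, x⁆ ∈ S := fun {x y} h => by
    rw [skew x y]; exact neg_mem h
  have mLH : ∀ α, ⁅L α, H⁆ ∈ S := fun α => hLH α ▸ S.smul_mem _ (mL α)
  have mLamH : ∀ α, ⁅Lam α, H⁆ ∈ S := fun α => hLamH α ▸ neg_mem (S.smul_mem _ (mLam α))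
  have mKH : ∀ α, ⁅K α, H⁆ ∈ S := fun α => hKH α ▸ S.zero_mem
  have mLL : ∀ α β, ⁅L α, L β⁆ ∈ S := fun α β => hLL α β ▸ S.zero_mem
  have mLamLam : ∀ α β, ⁅Lam α, Lam β⁆ ∈ S := fun α β => hLamLam α β ▸ S.zero_mem
  have mLLam : ∀ α β, ⁅L α, Lam β⁆ ∈ S := fun α β => by
    obtain rfl | rfl | rfl := Fin.eq_or_eq_add_one_or_eq_add_two α β
    · exact hLLam β ▸ neg_mem mH
    · exact hLLam1 α ▸ mK _
    · exact hLLam2 α ▸ neg_mem (mK _)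
  have mKL : ∀ α β, ⁅K α, L β⁆ ∈ S := fun α β => by
    obtain rfl | rfl | rfl := Fin.eq_or_eq_add_one_or_eq_add_two α β
    · exact hKL₀ β ▸ S.zero_mem
    · exact hKL₁ α ▸ neg_mem (S.smul_mem _ (mL _))
    · exact hKL₂ α ▸ S.smul_mem _ (mL _)
  have mKLam : ∀ α β, ⁅K α, Lam β⁆ ∈ S := fun α β => by
    obtain rfl | rfl | rfl := Fin.eq_or_eq_add_one_or_eq_add_two α β
    · exact hKLam₀ β ▸ S.zero_mem
    · exact hKLam₁ α ▸ neg_mem (S.smul_mem _ (mLam _))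
    · exact hKLam₂ α ▸ S.smul_mem _ (mLam _)
  have mKK₁ : ∀ α, ⁅K α, K (α + 1)⁆ ∈ S := fun α => hKK α ▸ neg_mem (S.smul_mem _ (mK _))
  have mKK : ∀ α β, ⁅K α, K β⁆ ∈ S := fun α β => by
    obtain rfl | rfl | rfl := Fin.eq_or_eq_add_one_or_eq_add_two α β
    · exact (lie_self (K β)).symm ▸ S.zero_mem
    · exact mKK₁ α
    · have h := swap (mKK₁ (α + 2))
      rwa [h21] at h
  rintro x (((rfl | ⟨α, rfl⟩) | ⟨α, rfl⟩) | ⟨α, rfl⟩) y (((rfl | ⟨β, rfl⟩) | ⟨β, rfl⟩) | ⟨β, rfl⟩)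
  · exact (lie_self y).symm ▸ S.zero_mem
  · exact swap (mLH β)
  · exact swap (mLamH β)
  · exact swap (mKH β)
  · exact mLH α
  · exact mLL α β
  · exact mLLam α β
  · exact swap (mKL β α)
  · exact mLamH α
  · exact swap (mLLam β α)
  · exact mLamLam α β
  · exact swap (mKLam β α)
  · exact mKH α
  · exact mKL α β
  · exact mKLam α β
  · exact mKK α β
end

section
/- Let n ∈ ℕ, let a : ℤ → ℕ be a sequence with a_j = 0 for all j < 0, and define b_k := a_k + 3a_{k−1} + 3a_{k−2} + a_{k−3} for k ≥ 0. If a_{2l} ≥ binom(l+2, 2) for every 0 ≤ l ≤ n, then b_k ≥ binom(k+2, 2) for every 0 ≤ k ≤ 2n+1. -/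
theorem choose_two_even (m : ℕ) :
    (2 * m + 2).choose 2 = (m + 2).choose 2 + 3 * (m + 1).choose 2 := by
  induction m with
  | zero => rfl
  | succ m ih =>
    simp only [Nat.mul_add, Nat.choose_succ_succ', Nat.choose_zero_right, Nat.choose_one_right,
      zero_add, mul_one] at ih ⊢
    omega

theorem choose_two_odd (m : ℕ) :
    (2 * m + 3).choose 2 = 3 * (m + 2).choose 2 + (m + 1).choose 2 := by
  have h := choose_two_even m
  simp only [Nat.choose_succ_succ', Nat.choose_zero_right, Nat.choose_one_right,
    zero_add] at h ⊢
  omega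

/-- Let `a : ℤ → ℕ` with `a j = 0` for `j < 0` and
`b k := a k + 3 a (k−1) + 3 a (k−2) + a (k−3)` for `k ≥ 0`.  If
`a (2l) ≥ C(l+2, 2)` for every `0 ≤ l ≤ n`, then `b k ≥ C(k+2, 2)` for every
`0 ≤ k ≤ 2n+1`. -/
theorem stmt9 (n : ℕ) (a b : ℤ → ℕ)
    (ha_neg : ∀ j : ℤ, j < 0 → a j = 0)
    (hb : ∀ k : ℤ, 0 ≤ k → b k = a k + 3 * a (k - 1) + 3 * a (k - 2) + a (k - 3))
    (ha : ∀ l : ℕ, l ≤ n → (l + 2).choose 2 ≤ a (2 * l)) :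
    ∀ k : ℕ, k ≤ 2 * n + 1 → (k + 2).choose 2 ≤ b k := by
  intro k hk
  have h_prev (m : ℕ) (hm : m ≤ n) : (m + 1).choose 2 ≤ a (2 * m - 2) := by
    cases m with
    | zero => simp
    | succ m =>
      have h := ha m (by omega)
      rwa [show (2 * ((m + 1 : ℕ) : ℤ) - 2) = 2 * m by push_cast; ring]
  have h_bk := hb k (by positivity)
  obtain ⟨m, rfl | rfl⟩ := k.even_or_odd'
  · have h₁ := ha m (by omega)
    have h₂ := h_prev m (by omega)
    rw [choose_two_even]
    push_cast at h_bk ⊢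
    omega
  · have h₁ := ha m (by omega)
    have h₂ := h_prev m (by omega)
    rw [show 2 * m + 1 + 2 = 2 * m + 3 by ring, choose_two_odd]
    push_cast at h_bk ⊢
    rw [show (2 * (m : ℤ) + 1 - 1) = 2 * m by ring,
      show (2 * (m : ℤ) + 1 - 3) = 2 * m - 2 by ring] at h_bk
    omega
end
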